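/- arXiv:2605.16700 — 4 statements merged into one kernel-verified Lean document; each statement's English description precedes it below -/
import Mathlib

section
/- For every measurable function q : ℝ → [0,∞), one has ∫_ℝ∫_ℝ q(u)·q(v)·|u−v| du dv ≥ (2/π²)·(∫_ℝ q(u)^{2/3} du)³, where both sides may equal +∞ and the inequality is understood in [0,∞]. -/
open MeasureTheory Real Set
open scoped ENNReal

/-- A monotone `F` with values in `(0, M)` on `s` and derivative `q` there satisfies
`∫_s q / √(F (M - F)) ≤ π`, by the change of variables `arcsin (2 F / M - 1)`. -/
lemma lintegral_deriv_div_sqrt_le_pi {F q : ℝ → ℝ} {s : Set ℝ} {M : ℝ} (hs : MeasurableSet s)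
    (hF : Monotone F) (hd : ∀ x ∈ s, HasDerivAt F (q x) x) (h0 : ∀ x ∈ s, 0 < F x)
    (hM : ∀ x ∈ s, F x < M) :
    ∫⁻ x in s, ENNReal.ofReal (q x / √(F x * (M - F x))) ≤ ENNReal.ofReal π := by
  have hd' : ∀ x ∈ s, HasDerivWithinAt (fun x ↦ arcsin (2 * F x / M - 1))
      (q x / √(F x * (M - F x))) s x := by
    intro x hx
    have hF0 := h0 x hx
    have hFM := hM x hx
    have hM0 : 0 < M := hF0.trans hFM
    have h1 : 2 * F x / M - 1 ≠ -1 := by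
      have : 0 < 2 * F x / M := by positivity
      linarith
    have h2 : 2 * F x / M - 1 ≠ 1 := by
      have : 2 * F x / M < 2 := by rw [div_lt_iff₀ hM0]; linarith
      linarith
    have hder : HasDerivAt (fun x ↦ 2 * F x / M - 1) (2 * q x / M) x :=
      (((hd x hx).const_mul 2).div_const M).sub_const 1
    have hpos : 0 < F x * (M - F x) := mul_pos hF0 (sub_pos.2 hFM)
    have hsq : √(1 - (2 * F x / M - 1) ^ 2) = 2 * √(F x * (M - F x)) / M := by
      rw [Real.sqrt_eq_iff_eq_sq ?_ (by positivity), div_pow, mul_pow, Real.sq_sqrt hpos.le]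
      · field_simp
        ring
      · have : 1 - (2 * F x / M - 1) ^ 2 = 4 * (F x * (M - F x)) / M ^ 2 := by
          field_simp
          ring
        rw [this]
        positivity
    have := (hasDerivAt_arcsin h1 h2).comp x hder
    rw [hsq] at this
    refine (this.congr_deriv ?_).hasDerivWithinAt
    have := (Real.sqrt_pos.2 hpos).ne'
    field_simp
  have hmono : MonotoneOn (fun x ↦ arcsin (2 * F x / M - 1)) s := by
    intro x hx y _ hxy
    have : 0 ≤ M := ((h0 x hx).trans (hM x hx)).le
    have := hF hxy
    exact monotone_arcsin (by gcongr)
  rw [lintegral_deriv_eq_volume_image_of_monotoneOn hs hd' hmono]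
  calc volume ((fun x ↦ arcsin (2 * F x / M - 1)) '' s) ≤ volume (Icc (-(π / 2)) (π / 2)) := by
        refine measure_mono ?_
        rintro _ ⟨x, -, rfl⟩
        exact arcsin_mem_Icc _
    _ = ENNReal.ofReal π := by rw [Real.volume_Icc]; congr 1; ring

lemma lintegral_deriv_rpow_le {F q : ℝ → ℝ} {M : ℝ} (hq : Measurable q) (hq0 : ∀ u, 0 ≤ q u)
    (hF : Monotone F) (hd : ∀ᵐ x, HasDerivAt F (q x) x) (h0 : ∀ x, 0 ≤ F x)
    (hM : ∀ x, F x ≤ M) :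
    (∫⁻ u, ENNReal.ofReal ((q u) ^ ((2 : ℝ) / 3))) ^ 3 ≤
      ENNReal.ofReal (π ^ 2) * ∫⁻ x, ENNReal.ofReal (F x * (M - F x)) := by
  have hFm : Measurable F := hF.measurable
  obtain ⟨t, hts, htm, ht0⟩ := exists_measurable_superset_of_null (ae_iff.1 hd)
  have hd' : ∀ x ∈ tᶜ, HasDerivAt F (q x) x := fun x hx ↦ by
    by_contra h
    exact hx (hts h)
  let s : Set ℝ := tᶜ ∩ ({x | 0 < F x} ∩ {x | F x < M})
  have hs : MeasurableSet s := htm.compl.inter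
    ((measurableSet_lt measurable_const hFm).inter (measurableSet_lt hFm measurable_const))
  let f : ℝ → ℝ≥0∞ := fun x ↦ ENNReal.ofReal (q x / √(F x * (M - F x))) ^ ((2 : ℝ) / 3)
  let g : ℝ → ℝ≥0∞ := fun x ↦ ENNReal.ofReal (F x * (M - F x)) ^ ((1 : ℝ) / 3)
  have hfg : ∀ᵐ x, ENNReal.ofReal ((q x) ^ ((2 : ℝ) / 3)) = s.indicator (f * g) x := by
    filter_upwards [compl_mem_ae_iff.2 ht0] with x hx
    by_cases hxs : x ∈ s
    · have hpos : 0 < F x * (M - F x) := mul_pos hxs.2.1 (sub_pos.2 hxs.2.2)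
      have hq' := hq0 x
      rw [indicator_of_mem hxs]
      simp only [Pi.mul_apply, f, g]
      rw [ENNReal.ofReal_rpow_of_nonneg (by positivity) (by norm_num),
        ENNReal.ofReal_rpow_of_nonneg hpos.le (by norm_num),
        ← ENNReal.ofReal_mul (by positivity), Real.div_rpow hq' (by positivity),
        Real.sqrt_eq_rpow, ← Real.rpow_mul hpos.le]
      congr 1
      norm_num
      have := (Real.rpow_pos_of_pos hpos (1 / 3)).ne'
      field_simp
    · rw [indicator_of_notMem hxs]
      have hx0 : q x = 0 := by
        rcases (h0 x).eq_or_lt with h | h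
        · exact IsLocalMin.hasDerivAt_eq_zero
            (Filter.Eventually.of_forall fun y ↦ h ▸ h0 y) (hd' x hx)
        · have hxM : F x = M := (hM x).eq_or_lt.resolve_right fun h' ↦ hxs ⟨hx, h, h'⟩
          exact IsLocalMax.hasDerivAt_eq_zero
            (Filter.Eventually.of_forall fun y ↦ hxM ▸ hM y) (hd' x hx)
      rw [hx0, Real.zero_rpow (by norm_num), ENNReal.ofReal_zero]
  have hpq : ((3 : ℝ) / 2).HolderConjugate 3 := by
    rw [Real.holderConjugate_iff]
    norm_num
  have hf : Measurable f := by fun_prop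
  have hg : Measurable g := by fun_prop
  have holder := ENNReal.lintegral_mul_le_Lp_mul_Lq (volume.restrict s) hpq
    hf.aemeasurable hg.aemeasurable
  have hf' : ∫⁻ x in s, f x ^ ((3 : ℝ) / 2) ≤ ENNReal.ofReal π := by
    refine le_trans (le_of_eq ?_) (lintegral_deriv_div_sqrt_le_pi hs hF (q := q) (M := M)
      (fun x hx ↦ hd' x hx.1) (fun x hx ↦ hx.2.1) (fun x hx ↦ hx.2.2))
    refine lintegral_congr fun x ↦ ?_
    simp only [f]
    rw [← ENNReal.rpow_mul]
    norm_num
  have hg' : ∫⁻ x in s, g x ^ (3 : ℝ) ≤ ∫⁻ x, ENNReal.ofReal (F x * (M - F x)) := by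
    refine le_trans (le_of_eq ?_) (setLIntegral_le_lintegral s _)
    refine lintegral_congr fun x ↦ ?_
    simp only [g]
    rw [← ENNReal.rpow_mul]
    norm_num
  rw [lintegral_congr_ae hfg, lintegral_indicator hs]
  calc (∫⁻ x in s, (f * g) x) ^ 3
      ≤ (ENNReal.ofReal π ^ (1 / ((3 : ℝ) / 2)) *
          (∫⁻ x, ENNReal.ofReal (F x * (M - F x))) ^ (1 / (3 : ℝ))) ^ 3 := by
        gcongr
        exact holder.trans (by gcongr)
    _ = ENNReal.ofReal (π ^ 2) * ∫⁻ x, ENNReal.ofReal (F x * (M - F x)) := by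
        rw [mul_pow, ← ENNReal.rpow_natCast, ← ENNReal.rpow_natCast, ← ENNReal.rpow_mul,
          ← ENNReal.rpow_mul, ENNReal.ofReal_pow pi_pos.le, ← ENNReal.rpow_natCast]
        norm_num

lemma lintegral_lintegral_mul_abs_sub {p : ℝ → ℝ≥0∞} (hp : Measurable p) :
    ∫⁻ u, ∫⁻ v, p u * p v * ENNReal.ofReal |u - v| =
      2 * ∫⁻ t, (∫⁻ u in Iic t, p u) * ∫⁻ v in Ioi t, p v := by
  let A : ℝ → ℝ → ℝ≥0∞ := fun t ↦ (Iic t).indicator p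
  let B : ℝ → ℝ → ℝ≥0∞ := fun t ↦ (Ioi t).indicator p
  have hA : Measurable (Function.uncurry A) :=
    (hp.comp measurable_snd).indicator (measurableSet_le measurable_snd measurable_fst)
  have hB : Measurable (Function.uncurry B) :=
    (hp.comp measurable_snd).indicator (measurableSet_lt measurable_fst measurable_snd)
  have hA' : ∀ {α : Type} [MeasurableSpace α] {a b : α → ℝ}, Measurable a → Measurable b →
      Measurable fun x ↦ A (a x) (b x) := fun ha hb ↦ hA.comp (ha.prodMk hb)
  have hB' : ∀ {α : Type} [MeasurableSpace α] {a b : α → ℝ}, Measurable a → Measurable b →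
      Measurable fun x ↦ B (a x) (b x) := fun ha hb ↦ hB.comp (ha.prodMk hb)
  have hAB : ∀ u v, ∫⁻ t, A t u * B t v = p u * p v * ENNReal.ofReal (v - u) := by
    intro u v
    have : ∀ t, A t u * B t v = (Ico u v).indicator (fun _ ↦ p u * p v) t := by
      intro t
      simp only [A, B, indicator_apply, mem_Iic, mem_Ioi, mem_Ico]
      split_ifs <;> simp_all
    simp_rw [this]
    rw [lintegral_indicator measurableSet_Ico, setLIntegral_const, Real.volume_Ico]
  have hker : ∀ u v, p u * p v * ENNReal.ofReal |u - v| =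
      ∫⁻ t, (A t u * B t v + A t v * B t u) := by
    intro u v
    have hm : Measurable fun t ↦ A t u * B t v :=
      (hA' measurable_id measurable_const).mul (hB' measurable_id measurable_const)
    rw [lintegral_add_left hm, hAB, hAB, mul_comm (p v), ← mul_add]
    congr 1
    rcases le_total u v with h | h
    · rw [abs_of_nonpos (sub_nonpos.2 h), ENNReal.ofReal_of_nonpos (sub_nonpos.2 h), add_zero,
        neg_sub]
    · rw [abs_of_nonneg (sub_nonneg.2 h), ENNReal.ofReal_of_nonpos (sub_nonpos.2 h), zero_add]
  have hAt : ∀ t, Measurable (A t) := fun t ↦ hA' measurable_const measurable_id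
  have hBt : ∀ t, Measurable (B t) := fun t ↦ hB' measurable_const measurable_id
  have hK : Measurable fun x : (ℝ × ℝ) × ℝ ↦
      A x.1.1 x.1.2 * B x.1.1 x.2 + A x.1.1 x.2 * B x.1.1 x.1.2 := by
    refine ((hA' ?_ ?_).mul (hB' ?_ ?_)).add ((hA' ?_ ?_).mul (hB' ?_ ?_)) <;> fun_prop
  have hslice : ∀ t, ∫⁻ u, ∫⁻ v, (A t u * B t v + A t v * B t u) =
      2 * ((∫⁻ u in Iic t, p u) * ∫⁻ v in Ioi t, p v) := by
    intro t
    have h1 : ∀ u, ∫⁻ v, (A t u * B t v + A t v * B t u) =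
        A t u * (∫⁻ v, B t v) + (∫⁻ v, A t v) * B t u := fun u ↦ by
      rw [lintegral_add_left ((hBt t).const_mul _), lintegral_const_mul _ (hBt t),
        lintegral_mul_const _ (hAt t)]
    simp_rw [h1]
    rw [lintegral_add_left ((hAt t).mul_const _), lintegral_mul_const _ (hAt t),
      lintegral_const_mul _ (hBt t), two_mul, lintegral_indicator measurableSet_Iic,
      lintegral_indicator measurableSet_Ioi]
  simp_rw [hker]
  calc ∫⁻ u, ∫⁻ v, ∫⁻ t, (A t u * B t v + A t v * B t u)
      = ∫⁻ u, ∫⁻ t, ∫⁻ v, (A t u * B t v + A t v * B t u) := by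
        refine lintegral_congr fun u ↦ lintegral_lintegral_swap (Measurable.aemeasurable ?_)
        exact hK.comp (f := fun z : ℝ × ℝ ↦ ((z.2, u), z.1)) (by fun_prop)
    _ = ∫⁻ t, ∫⁻ u, ∫⁻ v, (A t u * B t v + A t v * B t u) := by
        refine lintegral_lintegral_swap (Measurable.aemeasurable ?_)
        exact (Measurable.lintegral_prod_right' hK).comp measurable_swap
    _ = _ := by
        simp_rw [hslice]
        exact lintegral_const_mul' _ _ (by simp)

lemma busemann_line_of_integrable (q : ℝ → ℝ) (hq : Measurable q) (hq0 : ∀ u, 0 ≤ q u)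
    (hi : Integrable q) :
    ENNReal.ofReal (2 / π ^ 2) *
        (∫⁻ u, ENNReal.ofReal ((q u) ^ ((2 : ℝ) / 3))) ^ 3
      ≤ ∫⁻ u, ∫⁻ v, ENNReal.ofReal (q u * q v * |u - v|) := by
  let F : ℝ → ℝ := fun x ↦ ∫ t in Iic x, q t
  let M : ℝ := ∫ t, q t
  have hF : Monotone F := fun x y hxy ↦ setIntegral_mono_set hi.integrableOn
    (Filter.Eventually.of_forall hq0) (Iic_subset_Iic.2 hxy).eventuallyLE
  have hF0 : ∀ x, 0 ≤ F x := fun x ↦ integral_nonneg hq0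
  have hFM : ∀ x, F x + ∫ t in Ioi x, q t = M := fun x ↦
    intervalIntegral.integral_Iic_add_Ioi hi.integrableOn hi.integrableOn
  have hI0 : ∀ x, 0 ≤ ∫ t in Ioi x, q t := fun x ↦ integral_nonneg hq0
  have hd : ∀ᵐ x, HasDerivAt F (q x) x := by
    filter_upwards [LocallyIntegrable.ae_hasDerivAt_integral hi.locallyIntegrable] with x hx
    have : F = fun x ↦ (∫ t in (0 : ℝ)..x, q t) + F 0 := by
      funext y
      rw [← intervalIntegral.integral_Iic_sub_Iic hi.integrableOn hi.integrableOn]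
      simp [F]
    rw [this]
    exact (hx 0).add_const _
  have key := lintegral_deriv_rpow_le hq hq0 hF hd hF0 (M := M)
    (fun x ↦ by linarith [hFM x, hI0 x])
  have hrhs : ∫⁻ u, ∫⁻ v, ENNReal.ofReal (q u * q v * |u - v|) =
      2 * ∫⁻ x, ENNReal.ofReal (F x * (M - F x)) := by
    have h1 : ∀ u v, ENNReal.ofReal (q u * q v * |u - v|) =
        ENNReal.ofReal (q u) * ENNReal.ofReal (q v) * ENNReal.ofReal |u - v| := fun u v ↦ by
      rw [ENNReal.ofReal_mul (mul_nonneg (hq0 u) (hq0 v)), ENNReal.ofReal_mul (hq0 u)]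
    simp_rw [h1]
    rw [lintegral_lintegral_mul_abs_sub hq.ennreal_ofReal]
    congr 1
    refine lintegral_congr fun x ↦ ?_
    rw [ENNReal.ofReal_mul (hF0 x), ← hFM x, add_sub_cancel_left,
      ofReal_integral_eq_lintegral_ofReal hi.integrableOn (Filter.Eventually.of_forall hq0),
      ofReal_integral_eq_lintegral_ofReal hi.integrableOn (Filter.Eventually.of_forall hq0)]
  rw [hrhs]
  calc _ ≤ ENNReal.ofReal (2 / π ^ 2) *
        (ENNReal.ofReal (π ^ 2) * ∫⁻ x, ENNReal.ofReal (F x * (M - F x))) := by gcongr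
    _ = _ := by
      rw [← mul_assoc, ← ENNReal.ofReal_mul (by positivity), div_mul_cancel₀ _ (by positivity)]
      norm_num

/-- **Busemann's inequality on the line.**  For every measurable `q : ℝ → [0,∞)`,
`∫_ℝ∫_ℝ q(u) q(v) |u−v| du dv ≥ (2/π²) (∫_ℝ q(u)^{2/3} du)³`,
both sides possibly infinite. -/
theorem busemann_line
    (q : ℝ → ℝ) (hq : Measurable q) (hq0 : ∀ u, 0 ≤ q u) :
    ENNReal.ofReal (2 / π ^ 2) *
        (∫⁻ u, ENNReal.ofReal ((q u) ^ ((2 : ℝ) / 3))) ^ 3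
      ≤ ∫⁻ u, ∫⁻ v, ENNReal.ofReal (q u * q v * |u - v|) := by
  let r : ℕ → ℝ → ℝ := fun n ↦ (Icc (-(n : ℝ)) n).indicator fun u ↦ min (q u) n
  have hr : ∀ n, Measurable (r n) := fun n ↦
    (hq.min measurable_const).indicator measurableSet_Icc
  have hr0 : ∀ n u, 0 ≤ r n u := fun n u ↦
    indicator_nonneg (fun x _ ↦ le_min (hq0 x) n.cast_nonneg) u
  have hrq : ∀ n u, r n u ≤ q u := fun n u ↦
    indicator_le' (fun _ _ ↦ min_le_left _ _) (fun x _ ↦ hq0 x) u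
  have hmono : ∀ u, Monotone fun n ↦ r n u := fun u m n hmn ↦ by
    have hmn' : (m : ℝ) ≤ n := Nat.cast_le.2 hmn
    refine (indicator_le_indicator_of_subset (Icc_subset_Icc (neg_le_neg hmn') hmn')
      (fun x ↦ le_min (hq0 x) m.cast_nonneg) u).trans (indicator_le_indicator ?_)
    exact min_le_min_left _ hmn'
  have hri : ∀ n, Integrable (r n) := fun n ↦ by
    refine (integrable_indicator_iff measurableSet_Icc).2 ?_
    refine Measure.integrableOn_of_bounded (M := n) (by simp)
      (hq.min measurable_const).aestronglyMeasurable (Filter.Eventually.of_forall fun x ↦ ?_)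
    rw [Real.norm_of_nonneg (le_min (hq0 x) n.cast_nonneg)]
    exact min_le_right _ _
  have hlim : ∀ u, ∀ᶠ n : ℕ in Filter.atTop, r n u = q u := fun u ↦ by
    filter_upwards [tendsto_natCast_atTop_atTop.eventually_ge_atTop (max |u| (q u))] with n hn
    have h := max_le_iff.1 hn
    simp only [r]
    rw [indicator_of_mem (mem_Icc.2 (abs_le.1 h.1)), min_eq_left h.2]
  have htend : Filter.Tendsto (fun n ↦ ∫⁻ u, ENNReal.ofReal ((r n u) ^ ((2 : ℝ) / 3)))
      Filter.atTop (nhds (∫⁻ u, ENNReal.ofReal ((q u) ^ ((2 : ℝ) / 3)))) := by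
    refine lintegral_tendsto_of_tendsto_of_monotone
      (fun n ↦ ((hr n).pow_const _).ennreal_ofReal.aemeasurable)
      (Filter.Eventually.of_forall fun u m n hmn ↦ ENNReal.ofReal_le_ofReal
        (Real.rpow_le_rpow (hr0 m u) (hmono u hmn) (by norm_num)))
      (Filter.Eventually.of_forall fun u ↦ tendsto_const_nhds.congr' ?_)
    filter_upwards [hlim u] with n hn
    rw [hn]
  refine le_of_tendsto' (ENNReal.Tendsto.const_mul
    (((ENNReal.continuous_pow 3).tendsto _).comp htend) (Or.inr ENNReal.ofReal_ne_top)) fun n ↦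
    (busemann_line_of_integrable (r n) (hr n) (hr0 n) (hri n)).trans ?_
  have := hrq n
  have := hr0 n
  gcongr with u v <;> apply_assumption
end

section
/- Let Ω ⊂ ℝ² be a compact convex set with nonempty interior, A = area(Ω), and let w : ℝ² × ℝ² → [0,1] be a measurable symmetric function vanishing outside Ω × Ω. Then for every x ∈ ℝ² and θ ∈ [0,2π), g_Ω(x,θ) ≥ (2√2/3)·A·a_Ω(x,θ)^{3/2}. -/
open MeasureTheory Filter Real Set
open scoped ENNReal Topology

noncomputable section

abbrev Pl := ℝ × ℝ

/-- Two straight segments cross if their relative interiors (open segments) meet. -/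
def PCross (x₁ x₂ x₃ x₄ : Pl) : Prop :=
  (openSegment ℝ x₁ x₂ ∩ openSegment ℝ x₃ x₄).Nonempty

/-- The uniform probability measure on `Ω` (normalized Lebesgue measure). -/
def unifOn (Ω : Set Pl) : Measure Pl := (volume Ω)⁻¹ • (volume.restrict Ω)

/-- Edge density `e_Ω(w)`. -/
def ePl (Ω : Set Pl) (w : Pl → Pl → ℝ) : ℝ≥0∞ :=
  ∫⁻ y, ∫⁻ z, ENNReal.ofReal (w y z) ∂(unifOn Ω) ∂(unifOn Ω)

open Classical in
/-- Indicator of the planar crossing event. -/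
def pCrossInd (x₁ x₂ x₃ x₄ : Pl) : ℝ≥0∞ := if PCross x₁ x₂ x₃ x₄ then 1 else 0

/-- Crossing functional `Cr_Ω(w)`. -/
def crPl (Ω : Set Pl) (w : Pl → Pl → ℝ) : ℝ≥0∞ :=
  ∫⁻ x₁, ∫⁻ x₂, ∫⁻ x₃, ∫⁻ x₄,
    ENNReal.ofReal (w x₁ x₂) * ENNReal.ofReal (w x₃ x₄) * pCrossInd x₁ x₂ x₃ x₄
      ∂(unifOn Ω) ∂(unifOn Ω) ∂(unifOn Ω) ∂(unifOn Ω)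

/-- The unit vector `v_θ = (cos θ, sin θ)`. -/
def vθ (θ : ℝ) : Pl := (Real.cos θ, Real.sin θ)

/-- The planar crossing flux `g_Ω(x,θ)` (with `A = area Ω`). -/
def gPl (A : ℝ) (w : Pl → Pl → ℝ) (x : Pl) (θ : ℝ) : ℝ≥0∞ :=
  (ENNReal.ofReal (A ^ 2))⁻¹ *
    ∫⁻ p in Set.Ioi (0:ℝ) ×ˢ Set.Ioi (0:ℝ),
      ENNReal.ofReal ((p.1 + p.2) * w (x + p.1 • vθ θ) (x - p.2 • vθ θ))

/-- The planar incidence flux `a_Ω(x,θ)` (with `A = area Ω`). -/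
def aPl (A : ℝ) (w : Pl → Pl → ℝ) (x : Pl) (θ : ℝ) : ℝ≥0∞ :=
  (ENNReal.ofReal (A ^ 2))⁻¹ *
    ∫⁻ p in Set.Ioi (0:ℝ) ×ˢ Set.Ioi (0:ℝ),
      ENNReal.ofReal (w (x + p.1 • vθ θ) (x - p.2 • vθ θ))

/-- The integral of a positive power of the positive part of `c - r` over `r > 0`. -/
theorem lintegral_Ioi_ofReal_max_sub_pow (c : ℝ) {n : ℕ} (hn : n ≠ 0) :
    ∫⁻ r in Set.Ioi (0 : ℝ), ENNReal.ofReal (max (c - r) 0 ^ n)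
      = ENNReal.ofReal (max c 0 ^ (n + 1) / (n + 1)) := by
  rcases le_total c 0 with hc | hc
  · rw [max_eq_right hc, setLIntegral_congr_fun (g := fun _ => 0) measurableSet_Ioi]
    · simp
    · intro r hr
      have hr : 0 < r := hr
      simp [max_eq_right (show c - r ≤ 0 by linarith), hn]
  · rw [max_eq_left hc, ← Set.Ioc_union_Ioi_eq_Ioi hc,
      lintegral_union measurableSet_Ioi (Set.Ioc_disjoint_Ioi le_rfl),
      setLIntegral_congr_fun (g := fun _ => 0) (s := Set.Ioi c) measurableSet_Ioi, lintegral_zero,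
      add_zero, setLIntegral_congr_fun (g := fun r => ENNReal.ofReal ((c - r) ^ n))
        measurableSet_Ioc, ← ofReal_integral_eq_lintegral_ofReal,
      ← intervalIntegral.integral_of_le hc]
    · simp [intervalIntegral.integral_comp_sub_left (fun r => r ^ n) c]
    · exact (Continuous.integrableOn_Icc (by fun_prop)).mono_set Set.Ioc_subset_Icc_self
    · filter_upwards [ae_restrict_mem measurableSet_Ioc] with r hr
      exact pow_nonneg (sub_nonneg.2 hr.2) n
    · intro r hr
      simp only [max_eq_left (sub_nonneg.2 hr.2)]
    · intro r hr
      have hr : c < r := hr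
      simp [max_eq_right (show c - r ≤ 0 by linarith), hn]

theorem lintegral_quadrant_ofReal_sub_add (t : ℝ) :
    ∫⁻ p in Set.Ioi (0 : ℝ) ×ˢ Set.Ioi (0 : ℝ), ENNReal.ofReal (t - (p.1 + p.2))
      = ENNReal.ofReal (max t 0 ^ 3 / 6) := by
  rw [Measure.volume_eq_prod, ← Measure.prod_restrict, lintegral_prod _ (by fun_prop)]
  have inner (s : ℝ) : ∫⁻ r in Set.Ioi (0 : ℝ), ENNReal.ofReal (t - (s + r))
      = ENNReal.ofReal (1 / 2) * ENNReal.ofReal (max (t - s) 0 ^ 2) := by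
    have h := lintegral_Ioi_ofReal_max_sub_pow (t - s) one_ne_zero
    rw [← ENNReal.ofReal_mul (by norm_num)]
    convert h using 3
    · rw [pow_one, ← sub_sub]
      simp
    · norm_num
      ring
  simp only [inner]
  rw [lintegral_const_mul' _ _ ENNReal.ofReal_ne_top,
    lintegral_Ioi_ofReal_max_sub_pow t two_ne_zero, ← ENNReal.ofReal_mul (by norm_num)]
  congr 1
  norm_num
  ring

theorem ofReal_mul_lintegral_le_lintegral_add_mul_add (f : ℝ × ℝ → ℝ)
    (hf : ∀ p, f p ∈ Set.Icc (0 : ℝ) 1) {t : ℝ} (ht : 0 ≤ t) :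
    ENNReal.ofReal t * ∫⁻ p in Set.Ioi (0 : ℝ) ×ˢ Set.Ioi (0 : ℝ), ENNReal.ofReal (f p)
      ≤ (∫⁻ p in Set.Ioi (0 : ℝ) ×ˢ Set.Ioi (0 : ℝ), ENNReal.ofReal ((p.1 + p.2) * f p))
        + ENNReal.ofReal (t ^ 3 / 6) := by
  have h := lintegral_quadrant_ofReal_sub_add t
  rw [max_eq_left ht] at h
  rw [← h, ← lintegral_const_mul' _ _ ENNReal.ofReal_ne_top,
    ← lintegral_add_right _ (by fun_prop)]
  refine setLIntegral_mono' (measurableSet_Ioi.prod measurableSet_Ioi) ?_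
  rintro ⟨s, r⟩ ⟨hs, hr⟩
  have hs : 0 < s := hs
  have hr : 0 < r := hr
  obtain ⟨h0, h1⟩ := hf (s, r)
  rw [← ENNReal.ofReal_mul ht]
  rcases le_total (s + r) t with h | h
  · rw [← ENNReal.ofReal_add (by positivity) (by simpa using h)]
    exact ENNReal.ofReal_le_ofReal (by nlinarith)
  · exact (ENNReal.ofReal_le_ofReal (by nlinarith)).trans le_self_add

/-- The planar bathtub inequality on the open quadrant, for the weight `s + r`. -/
theorem ofReal_mul_lintegral_rpow_le_lintegral_add_mul (f : ℝ × ℝ → ℝ)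
    (hf : ∀ p, f p ∈ Set.Icc (0 : ℝ) 1) :
    ENNReal.ofReal (2 * √2 / 3) *
        (∫⁻ p in Set.Ioi (0 : ℝ) ×ˢ Set.Ioi (0 : ℝ), ENNReal.ofReal (f p)) ^ ((3 : ℝ) / 2)
      ≤ ∫⁻ p in Set.Ioi (0 : ℝ) ×ˢ Set.Ioi (0 : ℝ), ENNReal.ofReal ((p.1 + p.2) * f p) := by
  have key := fun t ht => ofReal_mul_lintegral_le_lintegral_add_mul_add f hf (t := t) ht
  generalize (∫⁻ p in Set.Ioi (0 : ℝ) ×ˢ Set.Ioi (0 : ℝ), ENNReal.ofReal (f p)) = M at *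
  generalize (∫⁻ p in Set.Ioi (0 : ℝ) ×ˢ Set.Ioi (0 : ℝ),
    ENNReal.ofReal ((p.1 + p.2) * f p)) = G at *
  rcases eq_or_ne G ⊤ with rfl | hG
  · exact le_top
  lift G to NNReal using hG
  rcases eq_or_ne M ⊤ with rfl | hM
  · simpa [ENNReal.mul_top] using key 1 zero_le_one
  lift M to NNReal using hM
  have hM := M.coe_nonneg
  have h := key (√2 * √M) (by positivity)
  rw [← ENNReal.ofReal_coe_nnreal, ← ENNReal.ofReal_coe_nnreal,
    ← ENNReal.ofReal_mul (by positivity), ← ENNReal.ofReal_add (by positivity) (by positivity),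
    ENNReal.ofReal_le_ofReal_iff (by positivity)] at h
  rw [← ENNReal.ofReal_coe_nnreal, ← ENNReal.ofReal_coe_nnreal,
    ENNReal.ofReal_rpow_of_nonneg hM (by norm_num), ← ENNReal.ofReal_mul (by positivity)]
  refine ENNReal.ofReal_le_ofReal ?_
  have e : (M : ℝ) ^ ((3 : ℝ) / 2) = √M ^ 3 := by
    rw [Real.sqrt_eq_rpow, ← Real.rpow_natCast, ← Real.rpow_mul hM]
    norm_num
  have h2 : √2 ^ 3 = 2 * √2 := by rw [pow_succ, Real.sq_sqrt zero_le_two]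
  have h3 : √2 * √M * M = √2 * √M ^ 3 := by rw [pow_succ (√(M : ℝ)), Real.sq_sqrt hM]; ring
  rw [mul_pow, h2, h3] at h
  rw [e]
  linarith

/-- **Pointwise planar flux estimate.**  Let `Ω ⊂ ℝ²` be compact convex with
nonempty interior, `A = area Ω`, and let `w : ℝ² × ℝ² → [0,1]` be measurable,
symmetric and vanishing outside `Ω × Ω`.  Then for every `x` and `θ ∈ [0,2π)`,
`g_Ω(x,θ) ≥ (2√2/3) A a_Ω(x,θ)^{3/2}`. -/
theorem planar_pointwise_flux_estimate
    (Ω : Set Pl) (hΩc : IsCompact Ω) (hΩconv : Convex ℝ Ω)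
    (hΩint : (interior Ω).Nonempty)
    (w : Pl → Pl → ℝ) (hmeas : Measurable (Function.uncurry w))
    (hsymm : ∀ x y, w x y = w y x)
    (hrange : ∀ x y, w x y ∈ Set.Icc (0:ℝ) 1)
    (hvanish : ∀ x y, ¬ (x ∈ Ω ∧ y ∈ Ω) → w x y = 0)
    (x : Pl) (θ : ℝ) (hθ : θ ∈ Set.Ico 0 (2 * π)) :
    ENNReal.ofReal (2 * Real.sqrt 2 / 3 * (volume Ω).toReal) *
        (aPl (volume Ω).toReal w x θ) ^ ((3 : ℝ) / 2)
      ≤ gPl (volume Ω).toReal w x θ := by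
  have hA : 0 < (volume Ω).toReal :=
    ENNReal.toReal_pos (Measure.measure_pos_of_nonempty_interior _ hΩint).ne' hΩc.measure_lt_top.ne
  generalize (volume Ω).toReal = A at *
  have h := ofReal_mul_lintegral_rpow_le_lintegral_add_mul
    (fun p => w (x + p.1 • vθ θ) (x - p.2 • vθ θ)) (fun _ => hrange _ _)
  have hpow : (A ^ 2)⁻¹ ^ ((3 : ℝ) / 2) = (A ^ 3)⁻¹ := by
    rw [Real.inv_rpow (by positivity), ← Real.rpow_natCast, ← Real.rpow_mul hA.le,
      ← Real.rpow_natCast]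
    norm_num
  have hscale : ENNReal.ofReal (2 * √2 / 3 * A) * ENNReal.ofReal (A ^ 2)⁻¹ ^ ((3 : ℝ) / 2)
      = ENNReal.ofReal (A ^ 2)⁻¹ * ENNReal.ofReal (2 * √2 / 3) := by
    rw [ENNReal.ofReal_rpow_of_nonneg (by positivity) (by norm_num), hpow,
      ← ENNReal.ofReal_mul (by positivity), ← ENNReal.ofReal_mul (by positivity)]
    congr 1
    field_simp
  unfold aPl gPl
  rw [ENNReal.mul_rpow_of_nonneg _ _ (by norm_num), ← mul_assoc,
    ← ENNReal.ofReal_inv_of_pos (by positivity), hscale, mul_assoc]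
  gcongr
end
end

section
/- Let Ω ⊂ ℝ² be a compact convex set with nonempty interior, A = area(Ω), and let w : ℝ² × ℝ² → [0,1] be a measurable symmetric function vanishing outside Ω × Ω. Then Cr_Ω(w) = ∫_Ω ∫₀^{2π} ∫₀^{2π} g_Ω(x,θ)·g_Ω(x,φ)·|sin(θ−φ)| dθ dφ dx, and e_Ω(w) = ∫_Ω ∫₀^{2π} a_Ω(x,θ) dθ dx. -/
open MeasureTheory Filter Real Set
open scoped ENNReal Topology

noncomputable section

theorem measurable_lintegral_param {α β : Type*} [MeasurableSpace α] [MeasurableSpace β]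
    {ν : Measure β} [SFinite ν] {f : α → β → ℝ≥0∞}
    (hf : Measurable fun p : α × β => f p.1 p.2) : Measurable fun a => ∫⁻ b, f a b ∂ν :=
  hf.lintegral_prod_right'

theorem lintegral_lintegral_swap_of_measurable {α β : Type*} [MeasurableSpace α]
    [MeasurableSpace β] {μ : Measure α} {ν : Measure β} [SFinite μ] [SFinite ν]
    {f : α → β → ℝ≥0∞} (hf : Measurable fun p : α × β => f p.1 p.2) :
    ∫⁻ a, ∫⁻ b, f a b ∂ν ∂μ = ∫⁻ b, ∫⁻ a, f a b ∂μ ∂ν :=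
  lintegral_lintegral_swap hf.aemeasurable

@[fun_prop]
theorem measurable_vθ : Measurable vθ := by
  unfold vθ; fun_prop

/-- Polar coordinates in the plane, with angles in `[0, 2π)`. -/
theorem lintegral_eq_polar {f : Pl → ℝ≥0∞} (hf : Measurable f) :
    ∫⁻ X, f X = ∫⁻ θ in Ico 0 (2 * π), ∫⁻ t in Ioi (0 : ℝ), ENNReal.ofReal t * f (t • vθ θ) := by
  have h1 : ∫⁻ X, f X = ∫⁻ X, f (-X) := (lintegral_neg_eq_self f).symm
  have hm : Measurable fun p : ℝ × ℝ => ENNReal.ofReal p.1 * f (-(p.1 • vθ p.2)) :=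
    Measurable.mul (by fun_prop) (hf.comp (by fun_prop))
  rw [h1, ← lintegral_comp_polarCoord_symm]
  have h2 : ∀ p : ℝ × ℝ, ENNReal.ofReal p.1 • f (-(polarCoord.symm p)) =
      ENNReal.ofReal p.1 * f (-(p.1 • vθ p.2)) := fun p => by
    simp [polarCoord, vθ]
  simp_rw [h2]
  change ∫⁻ p in Ioi (0 : ℝ) ×ˢ Ioo (-π) π, _ = _
  rw [Measure.volume_eq_prod, setLIntegral_prod_symm _ hm.aemeasurable,
    setLIntegral_congr (Ioo_ae_eq_Ico (μ := volume)), ← lintegral_indicator measurableSet_Ico,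
    ← lintegral_indicator measurableSet_Ico, ← lintegral_sub_right_eq_self _ π]
  refine lintegral_congr fun θ => ?_
  have h3 : vθ (θ - π) = -vθ θ := by simp [vθ, Real.cos_sub_pi, Real.sin_sub_pi]
  by_cases h : θ ∈ Ico 0 (2 * π)
  · have h' : θ - π ∈ Ico (-π) π := ⟨by linarith [h.1], by linarith [h.2]⟩
    rw [indicator_of_mem h, indicator_of_mem h']
    simp [h3]
  · have h' : θ - π ∉ Ico (-π) π := fun h' => h ⟨by linarith [h'.1], by linarith [h'.2]⟩
    rw [indicator_of_notMem h, indicator_of_notMem h']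

theorem setLIntegral_Ioo_eq_mul {t : ℝ} (ht : 0 < t) (f : ℝ → ℝ≥0∞) :
    ∫⁻ s in Ioo 0 t, f s = ENNReal.ofReal t * ∫⁻ σ in Ioo (0 : ℝ) 1, f (t * σ) := by
  have h : (fun σ => t * σ) '' Ioo (0 : ℝ) 1 = Ioo 0 t := by
    simpa using image_mul_left_Ioo ht 0 1
  rw [← h, lintegral_image_eq_lintegral_abs_deriv_mul (f' := fun _ => t) measurableSet_Ioo
    (fun x _ => by simpa using ((hasDerivAt_id x).const_mul t).hasDerivWithinAt)
    ((mul_right_injective₀ ht.ne').injOn), abs_of_pos ht,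
    lintegral_const_mul' _ _ ENNReal.ofReal_ne_top]

/-- Integration over the quadrant `s, r > 0` in the coordinates `t = s + r`, `σ = s / t`. -/
theorem lintegral_quadrant {k : ℝ → ℝ → ℝ≥0∞} (hk : Measurable fun p : ℝ × ℝ => k p.1 p.2) :
    ∫⁻ p in Ioi (0 : ℝ) ×ˢ Ioi (0 : ℝ), k p.1 (p.1 + p.2) =
      ∫⁻ t in Ioi (0 : ℝ), ENNReal.ofReal t * ∫⁻ σ in Ioo (0 : ℝ) 1, k (t * σ) t := by
  have hm : Measurable fun p : ℝ × ℝ => k p.1 (p.1 + p.2) :=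
    hk.comp (f := fun p : ℝ × ℝ => (p.1, p.1 + p.2)) (by fun_prop)
  have hS : MeasurableSet {p : ℝ × ℝ | 0 < p.1 ∧ p.1 < p.2} :=
    (measurableSet_lt measurable_const measurable_fst).inter
      (measurableSet_lt measurable_fst measurable_snd)
  have hm' : Measurable fun p : ℝ × ℝ =>
      indicator {p : ℝ × ℝ | 0 < p.1 ∧ p.1 < p.2} (fun p => k p.1 p.2) p := hk.indicator hS
  calc ∫⁻ p in Ioi (0 : ℝ) ×ˢ Ioi (0 : ℝ), k p.1 (p.1 + p.2)
      = ∫⁻ s : ℝ, ∫⁻ t : ℝ,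
          indicator {p : ℝ × ℝ | 0 < p.1 ∧ p.1 < p.2} (fun p => k p.1 p.2) (s, t) := by
        rw [Measure.volume_eq_prod, setLIntegral_prod _ hm.aemeasurable,
          ← lintegral_indicator measurableSet_Ioi]
        refine lintegral_congr fun s => ?_
        by_cases hs : 0 < s
        · rw [indicator_of_mem (mem_Ioi.2 hs), ← lintegral_indicator measurableSet_Ioi,
            ← lintegral_add_left_eq_self (indicator {p : ℝ × ℝ | 0 < p.1 ∧ p.1 < p.2}
              (fun p => k p.1 p.2) ⟨s, ·⟩) s]
          refine lintegral_congr fun r => ?_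
          simp [indicator, hs]
        · simp [indicator, hs]
    _ = ∫⁻ t : ℝ, ∫⁻ s : ℝ,
          indicator {p : ℝ × ℝ | 0 < p.1 ∧ p.1 < p.2} (fun p => k p.1 p.2) (s, t) :=
        lintegral_lintegral_swap_of_measurable hm'
    _ = _ := by
        rw [← lintegral_indicator measurableSet_Ioi]
        refine lintegral_congr fun t => ?_
        by_cases ht : 0 < t
        · rw [indicator_of_mem (mem_Ioi.2 ht), ← setLIntegral_Ioo_eq_mul ht (fun s => k s t),
            ← lintegral_indicator measurableSet_Ioo]
          rfl
        · rw [indicator_of_notMem (by simpa using ht)]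
          refine lintegral_eq_zero_of_ae_eq_zero (.of_forall fun s => indicator_of_notMem ?_ _)
          rintro ⟨h1, h2⟩
          exact ht (h1.trans h2)

theorem mem_openSegment_sub_iff {x X z : Pl} :
    z ∈ openSegment ℝ x (x - X) ↔ ∃ σ ∈ Ioo (0 : ℝ) 1, z = x - σ • X := by
  rw [openSegment_eq_image']
  simp only [mem_image, sub_sub_cancel_left, smul_neg, ← sub_eq_add_neg]
  exact ⟨fun ⟨σ, h, e⟩ => ⟨σ, h, e.symm⟩, fun ⟨σ, h, e⟩ => ⟨σ, h, e.symm⟩⟩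

theorem pCross_sub_iff {x X z Y : Pl} :
    PCross x (x - X) z (z - Y) ↔
      z ∈ (fun p : ℝ × ℝ => x - p.1 • X + p.2 • Y) '' (Ioo 0 1 ×ˢ Ioo 0 1) := by
  constructor
  · rintro ⟨q, h1, h2⟩
    obtain ⟨σ, hσ, rfl⟩ := mem_openSegment_sub_iff.1 h1
    obtain ⟨τ, hτ, e⟩ := mem_openSegment_sub_iff.1 h2
    exact ⟨(σ, τ), ⟨hσ, hτ⟩, by simp [e]⟩
  · rintro ⟨⟨σ, τ⟩, ⟨hσ, hτ⟩, rfl⟩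
    exact ⟨x - σ • X, mem_openSegment_sub_iff.2 ⟨σ, hσ, rfl⟩,
      mem_openSegment_sub_iff.2 ⟨τ, hτ, by simp⟩⟩

/-- The determinant of two plane vectors. -/
def det2 (X Y : Pl) : ℝ := X.1 * Y.2 - X.2 * Y.1

/-- The points `z` for which `[z, z - Y]` crosses `[x, x - X]` form a parallelogram. -/
theorem lintegral_mul_pCrossInd {X Y : Pl} (h : det2 X Y ≠ 0) (x : Pl) {F : Pl → ℝ≥0∞}
    (hF : Measurable F) :
    ∫⁻ z, F z * pCrossInd x (x - X) z (z - Y) =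
      ENNReal.ofReal |det2 X Y| * ∫⁻ σ in Ioo (0 : ℝ) 1, ∫⁻ τ in Ioo (0 : ℝ) 1,
        F (x - σ • X + τ • Y) := by
  let f' : ℝ × ℝ →L[ℝ] Pl :=
    (ContinuousLinearMap.fst ℝ ℝ ℝ).smulRight (-X) + (ContinuousLinearMap.snd ℝ ℝ ℝ).smulRight Y
  have hf : ∀ p : ℝ × ℝ, x - p.1 • X + p.2 • Y = x + f' p := fun p => by
    simp [f', sub_eq_add_neg, add_assoc]
  have hder : ∀ p ∈ Ioo (0 : ℝ) 1 ×ˢ Ioo (0 : ℝ) 1, HasFDerivWithinAt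
      (fun p : ℝ × ℝ => x - p.1 • X + p.2 • Y) f' (Ioo (0 : ℝ) 1 ×ˢ Ioo (0 : ℝ) 1) p :=
    fun p _ => by
      simp_rw [hf]
      exact (f'.hasFDerivAt.const_add x).hasFDerivWithinAt
  have hdet : |f'.det| = |det2 X Y| := by
    have : f'.det = -det2 X Y := by
      change LinearMap.det (f' : ℝ × ℝ →ₗ[ℝ] ℝ × ℝ) = _
      rw [← LinearMap.det_toMatrix (Module.Basis.finTwoProd ℝ), Matrix.det_fin_two]
      simp [LinearMap.toMatrix_apply, f', det2]
      ring
    rw [this, abs_neg]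
  have hinj : InjOn (fun p : ℝ × ℝ => x - p.1 • X + p.2 • Y) (Ioo (0 : ℝ) 1 ×ˢ Ioo (0 : ℝ) 1) := by
    rintro ⟨a, b⟩ - ⟨c, d⟩ - e
    simp only [Prod.ext_iff, Prod.fst_add, Prod.fst_sub, Prod.smul_fst, Prod.snd_add,
      Prod.snd_sub, Prod.smul_snd, smul_eq_mul] at e
    obtain ⟨e1, e2⟩ := e
    have h1 : (a - c) * det2 X Y = 0 := by
      unfold det2; linear_combination Y.1 * e2 - Y.2 * e1
    have h2 : (b - d) * det2 X Y = 0 := by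
      unfold det2; linear_combination X.1 * e2 - X.2 * e1
    ext
    · simpa [h, sub_eq_zero] using h1
    · simpa [h, sub_eq_zero] using h2
  have hmeas : MeasurableSet (Ioo (0 : ℝ) 1 ×ˢ Ioo (0 : ℝ) 1) :=
    measurableSet_Ioo.prod measurableSet_Ioo
  have himg := measurable_image_of_fderivWithin hmeas hder hinj
  have hind : ∀ z, F z * pCrossInd x (x - X) z (z - Y) =
      indicator ((fun p : ℝ × ℝ => x - p.1 • X + p.2 • Y) '' (Ioo 0 1 ×ˢ Ioo 0 1)) F z := by
    intro z
    by_cases hz : PCross x (x - X) z (z - Y)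
    · rw [indicator_of_mem (pCross_sub_iff.1 hz), pCrossInd, if_pos hz, mul_one]
    · rw [indicator_of_notMem (mt pCross_sub_iff.2 hz), pCrossInd, if_neg hz, mul_zero]
  simp_rw [hind]
  rw [lintegral_indicator himg, lintegral_image_eq_lintegral_abs_det_fderiv_mul _ hmeas hder hinj,
    hdet, lintegral_const_mul' _ _ ENNReal.ofReal_ne_top, Measure.volume_eq_prod,
    setLIntegral_prod]
  exact (hF.comp (by fun_prop)).aemeasurable

theorem measurableSet_pCross :
    MeasurableSet {p : Pl × Pl × Pl × Pl | PCross p.1 p.2.1 p.2.2.1 p.2.2.2} := by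
  let R : Set ((ℝ × ℝ) × (Pl × Pl × Pl × Pl)) :=
    {q | q.2.1 + q.1.1 • (q.2.2.1 - q.2.1) = q.2.2.2.1 + q.1.2 • (q.2.2.2.2 - q.2.2.2.1)}
  have hR : IsClosed R := isClosed_eq (by fun_prop) (by fun_prop)
  have hO : IsOpen ((Ioo (0 : ℝ) 1 ×ˢ Ioo (0 : ℝ) 1) ×ˢ (univ : Set (Pl × Pl × Pl × Pl))) :=
    (isOpen_Ioo.prod isOpen_Ioo).prod isOpen_univ
  obtain ⟨F, hFc, -, hFU, -⟩ := hO.exists_iUnion_isClosed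
  have : {p : Pl × Pl × Pl × Pl | PCross p.1 p.2.1 p.2.2.1 p.2.2.2} =
      ⋃ n : ℕ, ⋃ m : ℕ, Prod.snd '' (F n ∩ R ∩ Metric.closedBall 0 m) := by
    ext ⟨x₁, x₂, x₃, x₄⟩
    simp only [mem_ofPred_eq, PCross, openSegment_eq_image', mem_iUnion, mem_image]
    constructor
    · rintro ⟨z, ⟨σ, hσ, e1⟩, τ, hτ, e2⟩
      have hq : (((σ, τ), (x₁, x₂, x₃, x₄)) : (ℝ × ℝ) × (Pl × Pl × Pl × Pl)) ∈ ⋃ n, F n := by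
        rw [hFU]; exact ⟨⟨hσ, hτ⟩, mem_univ _⟩
      obtain ⟨n, hn⟩ := mem_iUnion.1 hq
      obtain ⟨m, hm⟩ := exists_nat_ge
        (dist (((σ, τ), (x₁, x₂, x₃, x₄)) : (ℝ × ℝ) × (Pl × Pl × Pl × Pl)) 0)
      exact ⟨n, m, _, ⟨⟨hn, e1.trans e2.symm⟩, hm⟩, rfl⟩
    · rintro ⟨n, m, ⟨⟨σ, τ⟩, p⟩, ⟨⟨hn, hr⟩, -⟩, rfl⟩
      have hq := mem_iUnion.2 ⟨n, hn⟩
      rw [hFU] at hq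
      exact ⟨_, ⟨σ, hq.1.1, rfl⟩, τ, hq.1.2, hr.symm⟩
  rw [this]
  refine .iUnion fun n => .iUnion fun m => ?_
  refine (IsCompact.image ?_ continuous_snd).isClosed.measurableSet
  exact (isCompact_closedBall _ _).inter_left ((hFc n).inter hR)

theorem Measurable.pCrossInd {α : Type*} [MeasurableSpace α] {a b c d : α → Pl}
    (ha : Measurable a) (hb : Measurable b) (hc : Measurable c) (hd : Measurable d) :
    Measurable fun p => pCrossInd (a p) (b p) (c p) (d p) := by
  refine Measurable.ite ?_ measurable_const measurable_const
  exact (ha.prodMk (hb.prodMk (hc.prodMk hd))) measurableSet_pCross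

theorem Measurable.apply₂ {α : Type*} [MeasurableSpace α] {W : Pl → Pl → ℝ≥0∞}
    (hW : Measurable fun p : Pl × Pl => W p.1 p.2) {a b : α → Pl} (ha : Measurable a)
    (hb : Measurable b) : Measurable fun p => W (a p) (b p) :=
  hW.comp (ha.prodMk hb)

theorem ae_det2_ne_zero : ∀ᵐ X : Pl, ∀ᵐ Y : Pl, det2 X Y ≠ 0 := by
  have h0 : ∀ᵐ X : Pl, X ≠ 0 := by simp [ae_iff]
  filter_upwards [h0] with X hX
  let l : Pl →ₗ[ℝ] ℝ := X.1 • LinearMap.snd ℝ ℝ ℝ - X.2 • LinearMap.fst ℝ ℝ ℝ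
  have hl : LinearMap.ker l ≠ ⊤ := fun h => hX <| by
    have h1 : ((0, 1) : Pl) ∈ LinearMap.ker l := h ▸ Submodule.mem_top
    have h2 : ((1, 0) : Pl) ∈ LinearMap.ker l := h ▸ Submodule.mem_top
    ext
    · simpa [l] using h1
    · simpa [l] using h2
  have := Measure.addHaar_submodule volume _ hl
  rw [ae_iff]
  convert this using 2
  ext Y
  simp [l, det2]

theorem det2_smul_vθ {s t : ℝ} (hs : 0 < s) (ht : 0 < t) (θ φ : ℝ) :
    |det2 (s • vθ θ) (t • vθ φ)| = s * t * |Real.sin (θ - φ)| := by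
  have : det2 (s • vθ θ) (t • vθ φ) = -(s * t * Real.sin (θ - φ)) := by
    simp [det2, vθ, Real.sin_sub]; ring
  rw [this, abs_neg, abs_mul, abs_of_pos (mul_pos hs ht)]

/-- The bilinear form `∫∫ |det (X, Y)| L(X) L(Y)` in polar coordinates. -/
theorem lintegral_det2_mul_eq_polar {L : Pl → ℝ≥0∞} (hL : Measurable L) :
    ∫⁻ X, ∫⁻ Y, ENNReal.ofReal |det2 X Y| * (L X * L Y) =
      ∫⁻ θ in Ico 0 (2 * π), ∫⁻ φ in Ico 0 (2 * π),
        (∫⁻ t in Ioi (0 : ℝ), ENNReal.ofReal t * (ENNReal.ofReal t * L (t • vθ θ))) *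
        (∫⁻ t in Ioi (0 : ℝ), ENNReal.ofReal t * (ENNReal.ofReal t * L (t • vθ φ))) *
          ENNReal.ofReal |Real.sin (θ - φ)| := by
  have hd {α : Type} [MeasurableSpace α] {a b : α → Pl} (ha : Measurable a)
      (hb : Measurable b) : Measurable fun p =>
        ENNReal.ofReal |det2 (a p) (b p)| * (L (a p) * L (b p)) := by
    unfold det2
    fun_prop
  have hG : Measurable fun θ : ℝ =>
      ∫⁻ t in Ioi (0 : ℝ), ENNReal.ofReal t * (ENNReal.ofReal t * L (t • vθ θ)) :=
    measurable_lintegral_param (by fun_prop)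
  rw [lintegral_eq_polar (measurable_lintegral_param (hd (by fun_prop) (by fun_prop)))]
  refine lintegral_congr fun θ => ?_
  have hGS : Measurable fun φ : ℝ =>
      (∫⁻ t in Ioi (0 : ℝ), ENNReal.ofReal t * (ENNReal.ofReal t * L (t • vθ φ))) *
        ENNReal.ofReal |Real.sin (θ - φ)| := hG.mul (by fun_prop)
  simp_rw [mul_assoc]
  rw [lintegral_const_mul _ hGS, ← lintegral_mul_const _ (by fun_prop)]
  refine setLIntegral_congr_fun measurableSet_Ioi fun s hs => ?_
  rw [lintegral_eq_polar (hd (by fun_prop) (by fun_prop)), mul_assoc]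
  congr 1
  rw [← lintegral_const_mul _ hGS]
  refine lintegral_congr fun φ => ?_
  rw [← lintegral_mul_const _ (by fun_prop), ← lintegral_const_mul _ (by fun_prop)]
  refine setLIntegral_congr_fun measurableSet_Ioi fun t ht => ?_
  rw [det2_smul_vθ hs ht, ENNReal.ofReal_mul (mul_pos hs ht).le, ENNReal.ofReal_mul (le_of_lt hs)]
  ring

/-- The `W`-mass of the translates of the segment `[X, 0]` that contain `x`. -/
def chordMass (W : Pl → Pl → ℝ≥0∞) (x X : Pl) : ℝ≥0∞ :=
  ∫⁻ σ in Ioo (0 : ℝ) 1, W (x + σ • X) (x + σ • X - X)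

theorem measurable_chordMass {W : Pl → Pl → ℝ≥0∞}
    (hW : Measurable fun p : Pl × Pl => W p.1 p.2) :
    Measurable fun p : Pl × Pl => chordMass W p.1 p.2 :=
  measurable_lintegral_param (hW.apply₂ (by fun_prop) (by fun_prop))

theorem lintegral_chordMass {W : Pl → Pl → ℝ≥0∞}
    (hW : Measurable fun p : Pl × Pl => W p.1 p.2) :
    ∫⁻ x, ∫⁻ X, chordMass W x X = ∫⁻ y, ∫⁻ z, W y z := by
  calc ∫⁻ x, ∫⁻ X, chordMass W x X
      = ∫⁻ X, ∫⁻ x, chordMass W x X :=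
        lintegral_lintegral_swap_of_measurable (measurable_chordMass hW)
    _ = ∫⁻ X : Pl, ∫⁻ y, W y (y - X) := by
        refine lintegral_congr fun X => ?_
        unfold chordMass
        have hm : Measurable fun p : Pl × ℝ => W (p.1 + p.2 • X) (p.1 + p.2 • X - X) :=
          hW.apply₂ (by fun_prop) (by fun_prop)
        rw [lintegral_lintegral_swap_of_measurable hm]
        simp_rw [fun σ : ℝ => lintegral_add_right_eq_self (μ := (volume : Measure Pl))
          (fun y => W y (y - X)) (σ • X)]
        simp
    _ = ∫⁻ y, ∫⁻ X : Pl, W y (y - X) :=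
        lintegral_lintegral_swap_of_measurable (hW.apply₂ (by fun_prop) (by fun_prop))
    _ = _ := lintegral_congr fun y => lintegral_sub_left_eq_self (W y) y

theorem lintegral_chordMass_mul_chordMass {W : Pl → Pl → ℝ≥0∞}
    (hW : Measurable fun p : Pl × Pl => W p.1 p.2) (X Y : Pl) :
    ∫⁻ x, chordMass W x X * chordMass W x Y =
      ∫⁻ y, W y (y - X) * ∫⁻ σ in Ioo (0 : ℝ) 1, ∫⁻ τ in Ioo (0 : ℝ) 1,
        W (y - σ • X + τ • Y) (y - σ • X + τ • Y - Y) := by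
  have hm : Measurable fun p : (Pl × ℝ) × ℝ =>
      W (p.1.1 + p.1.2 • X) (p.1.1 + p.1.2 • X - X) *
        W (p.1.1 + p.2 • Y) (p.1.1 + p.2 • Y - Y) :=
    (hW.apply₂ (by fun_prop) (by fun_prop)).mul (hW.apply₂ (by fun_prop) (by fun_prop))
  have hm' : Measurable fun p : (Pl × ℝ) × ℝ =>
      W p.1.1 (p.1.1 - X) *
        W (p.1.1 - p.1.2 • X + p.2 • Y) (p.1.1 - p.1.2 • X + p.2 • Y - Y) :=
    (hW.apply₂ (by fun_prop) (by fun_prop)).mul (hW.apply₂ (by fun_prop) (by fun_prop))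
  calc ∫⁻ x, chordMass W x X * chordMass W x Y
      = ∫⁻ x, ∫⁻ σ in Ioo (0 : ℝ) 1, ∫⁻ τ in Ioo (0 : ℝ) 1,
          W (x + σ • X) (x + σ • X - X) * W (x + τ • Y) (x + τ • Y - Y) := by
        refine lintegral_congr fun x => (lintegral_lintegral_mul ?_ ?_).symm
        · exact (hW.apply₂ (by fun_prop) (by fun_prop)).aemeasurable
        · exact (hW.apply₂ (by fun_prop) (by fun_prop)).aemeasurable
    _ = ∫⁻ σ in Ioo (0 : ℝ) 1, ∫⁻ x, ∫⁻ τ in Ioo (0 : ℝ) 1,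
          W (x + σ • X) (x + σ • X - X) * W (x + τ • Y) (x + τ • Y - Y) :=
        lintegral_lintegral_swap_of_measurable (measurable_lintegral_param hm)
    _ = ∫⁻ σ in Ioo (0 : ℝ) 1, ∫⁻ y, ∫⁻ τ in Ioo (0 : ℝ) 1,
          W y (y - X) * W (y - σ • X + τ • Y) (y - σ • X + τ • Y - Y) := by
        refine lintegral_congr fun σ => ?_
        rw [← lintegral_sub_right_eq_self _ (σ • X)]
        simp only [sub_add_cancel]
    _ = ∫⁻ y, ∫⁻ σ in Ioo (0 : ℝ) 1, ∫⁻ τ in Ioo (0 : ℝ) 1,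
          W y (y - X) * W (y - σ • X + τ • Y) (y - σ • X + τ • Y - Y) :=
        (lintegral_lintegral_swap_of_measurable (measurable_lintegral_param hm')).symm
    _ = _ := by
        refine lintegral_congr fun y => ?_
        have hF : Measurable fun p : ℝ × ℝ =>
            W (y - p.1 • X + p.2 • Y) (y - p.1 • X + p.2 • Y - Y) :=
          hW.apply₂ (by fun_prop) (by fun_prop)
        rw [← lintegral_const_mul _ (measurable_lintegral_param hF)]
        exact lintegral_congr fun σ => lintegral_const_mul _ (hF.comp measurable_prodMk_left)

theorem lintegral_pCrossInd_of_det2_ne_zero {W : Pl → Pl → ℝ≥0∞}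
    (hW : Measurable fun p : Pl × Pl => W p.1 p.2) {X Y : Pl} (h : det2 X Y ≠ 0) :
    ∫⁻ x, ∫⁻ z, W x (x - X) * W z (z - Y) * pCrossInd x (x - X) z (z - Y) =
      ∫⁻ x, ENNReal.ofReal |det2 X Y| * (chordMass W x X * chordMass W x Y) := by
  rw [lintegral_const_mul' _ _ ENNReal.ofReal_ne_top, lintegral_chordMass_mul_chordMass hW,
    ← lintegral_const_mul' _ _ ENNReal.ofReal_ne_top]
  refine lintegral_congr fun x => ?_
  have hF : Measurable fun z => W z (z - Y) := hW.apply₂ (by fun_prop) (by fun_prop)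
  have hI : Measurable fun z => W z (z - Y) * pCrossInd x (x - X) z (z - Y) :=
    hF.mul (Measurable.pCrossInd (by fun_prop) (by fun_prop) (by fun_prop) (by fun_prop))
  simp_rw [mul_assoc]
  rw [lintegral_const_mul _ hI, lintegral_mul_pCrossInd h x hF, mul_left_comm]

theorem lintegral_pCrossInd {W : Pl → Pl → ℝ≥0∞}
    (hW : Measurable fun p : Pl × Pl => W p.1 p.2) :
    ∫⁻ x₁, ∫⁻ x₂, ∫⁻ x₃, ∫⁻ x₄, W x₁ x₂ * W x₃ x₄ * pCrossInd x₁ x₂ x₃ x₄ =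
      ∫⁻ x, ∫⁻ X, ∫⁻ Y, ENNReal.ofReal |det2 X Y| * (chordMass W x X * chordMass W x Y) := by
  have hm {α : Type} [MeasurableSpace α] {a b c d : α → Pl} (ha : Measurable a)
      (hb : Measurable b) (hc : Measurable c) (hd : Measurable d) : Measurable fun p =>
        W (a p) (a p - b p) * W (c p) (c p - d p) *
          pCrossInd (a p) (a p - b p) (c p) (c p - d p) :=
    ((hW.apply₂ ha (ha.sub hb)).mul (hW.apply₂ hc (hc.sub hd))).mul
      (Measurable.pCrossInd ha (ha.sub hb) hc (hc.sub hd))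
  have hL := measurable_chordMass hW
  have hr {α : Type} [MeasurableSpace α] {a b c : α → Pl} (ha : Measurable a)
      (hb : Measurable b) (hc : Measurable c) : Measurable fun p =>
        ENNReal.ofReal |det2 (b p) (c p)| *
          (chordMass W (a p) (b p) * chordMass W (a p) (c p)) := by
    refine Measurable.mul ?_ ((hL.apply₂ ha hb).mul (hL.apply₂ ha hc))
    unfold det2
    fun_prop
  calc ∫⁻ x₁, ∫⁻ x₂, ∫⁻ x₃, ∫⁻ x₄, W x₁ x₂ * W x₃ x₄ * pCrossInd x₁ x₂ x₃ x₄
      = ∫⁻ x : Pl, ∫⁻ X : Pl, ∫⁻ z : Pl, ∫⁻ Y : Pl,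
          W x (x - X) * W z (z - Y) * pCrossInd x (x - X) z (z - Y) := by
        refine lintegral_congr fun x => ?_
        rw [← lintegral_sub_left_eq_self _ x]
        refine lintegral_congr fun X => lintegral_congr fun z => ?_
        rw [← lintegral_sub_left_eq_self _ z]
    _ = ∫⁻ X : Pl, ∫⁻ x : Pl, ∫⁻ z : Pl, ∫⁻ Y : Pl,
          W x (x - X) * W z (z - Y) * pCrossInd x (x - X) z (z - Y) := by
        refine lintegral_lintegral_swap_of_measurable
          (measurable_lintegral_param (measurable_lintegral_param ?_))
        exact hm (by fun_prop) (by fun_prop) (by fun_prop) (by fun_prop)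
    _ = ∫⁻ X : Pl, ∫⁻ x : Pl, ∫⁻ Y : Pl, ∫⁻ z : Pl,
          W x (x - X) * W z (z - Y) * pCrossInd x (x - X) z (z - Y) := by
        refine lintegral_congr fun X => lintegral_congr fun x =>
          lintegral_lintegral_swap_of_measurable ?_
        exact hm (by fun_prop) (by fun_prop) (by fun_prop) (by fun_prop)
    _ = ∫⁻ X : Pl, ∫⁻ Y : Pl, ∫⁻ x : Pl, ∫⁻ z : Pl,
          W x (x - X) * W z (z - Y) * pCrossInd x (x - X) z (z - Y) := by
        refine lintegral_congr fun X => lintegral_lintegral_swap_of_measurable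
          (measurable_lintegral_param ?_)
        exact hm (by fun_prop) (by fun_prop) (by fun_prop) (by fun_prop)
    _ = ∫⁻ X : Pl, ∫⁻ Y : Pl, ∫⁻ x : Pl,
          ENNReal.ofReal |det2 X Y| * (chordMass W x X * chordMass W x Y) := by
        refine lintegral_congr_ae (ae_det2_ne_zero.mono fun X hX => ?_)
        exact lintegral_congr_ae (hX.mono fun Y hY => lintegral_pCrossInd_of_det2_ne_zero hW hY)
    _ = ∫⁻ X : Pl, ∫⁻ x : Pl, ∫⁻ Y : Pl,
          ENNReal.ofReal |det2 X Y| * (chordMass W x X * chordMass W x Y) := by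
        refine lintegral_congr fun X => lintegral_lintegral_swap_of_measurable ?_
        exact hr (by fun_prop) (by fun_prop) (by fun_prop)
    _ = _ := by
        refine lintegral_lintegral_swap_of_measurable (measurable_lintegral_param ?_)
        exact hr (by fun_prop) (by fun_prop) (by fun_prop)

theorem lintegral_quadrant_eq_chordMass {W : Pl → Pl → ℝ≥0∞}
    (hW : Measurable fun p : Pl × Pl => W p.1 p.2) (x : Pl) (θ : ℝ) :
    ∫⁻ p in Ioi (0 : ℝ) ×ˢ Ioi (0 : ℝ), W (x + p.1 • vθ θ) (x - p.2 • vθ θ) =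
      ∫⁻ t in Ioi (0 : ℝ), ENNReal.ofReal t * chordMass W x (t • vθ θ) := by
  have hk : Measurable fun p : ℝ × ℝ => W (x + p.1 • vθ θ) (x + p.1 • vθ θ - p.2 • vθ θ) :=
    hW.apply₂ (by fun_prop) (by fun_prop)
  have h := lintegral_quadrant (k := fun s t => W (x + s • vθ θ) (x + s • vθ θ - t • vθ θ)) hk
  have hl : ∀ p : ℝ × ℝ, x - p.2 • vθ θ = x + p.1 • vθ θ - (p.1 + p.2) • vθ θ := fun p => by
    module
  have hr : ∀ t σ : ℝ, (t * σ) • vθ θ = σ • (t • vθ θ) := fun t σ => by module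
  simp_rw [hr] at h
  exact (lintegral_congr fun p => by rw [hl]).trans h

theorem lintegral_quadrant_mul_eq_chordMass {W : Pl → Pl → ℝ≥0∞}
    (hW : Measurable fun p : Pl × Pl => W p.1 p.2) (x : Pl) (θ : ℝ) :
    ∫⁻ p in Ioi (0 : ℝ) ×ˢ Ioi (0 : ℝ),
        ENNReal.ofReal (p.1 + p.2) * W (x + p.1 • vθ θ) (x - p.2 • vθ θ) =
      ∫⁻ t in Ioi (0 : ℝ), ENNReal.ofReal t *
        (ENNReal.ofReal t * chordMass W x (t • vθ θ)) := by
  have hk : Measurable fun p : ℝ × ℝ =>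
      ENNReal.ofReal p.2 * W (x + p.1 • vθ θ) (x + p.1 • vθ θ - p.2 • vθ θ) :=
    Measurable.mul (by fun_prop) (hW.apply₂ (by fun_prop) (by fun_prop))
  have h := lintegral_quadrant
    (k := fun s t => ENNReal.ofReal t * W (x + s • vθ θ) (x + s • vθ θ - t • vθ θ)) hk
  have hl : ∀ p : ℝ × ℝ, x - p.2 • vθ θ = x + p.1 • vθ θ - (p.1 + p.2) • vθ θ := fun p => by
    module
  have hr : ∀ t σ : ℝ, (t * σ) • vθ θ = σ • (t • vθ θ) := fun t σ => by module
  simp_rw [hr, lintegral_const_mul' _ _ ENNReal.ofReal_ne_top] at h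
  exact (lintegral_congr fun p => by rw [hl]).trans h

theorem chordMass_eq_zero {Ω : Set Pl} (hΩ : Convex ℝ Ω) {W : Pl → Pl → ℝ≥0∞}
    (hW : ∀ x y, ¬ (x ∈ Ω ∧ y ∈ Ω) → W x y = 0) {x : Pl} (hx : x ∉ Ω) (X : Pl) :
    chordMass W x X = 0 := by
  refine setLIntegral_eq_zero measurableSet_Ioo fun σ hσ => hW _ _ fun ⟨h1, h2⟩ => hx ?_
  convert hΩ h1 h2 (sub_nonneg.2 hσ.2.le) hσ.1.le (sub_add_cancel 1 σ) using 1
  module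

theorem setLIntegral_eq_lintegral_of_forall_notMem {Ω : Set Pl} (hΩ : MeasurableSet Ω)
    {f : Pl → ℝ≥0∞} (hf : ∀ x ∉ Ω, f x = 0) : ∫⁻ x in Ω, f x = ∫⁻ x, f x := by
  rw [← lintegral_indicator hΩ]
  exact lintegral_congr fun x => by
    by_cases h : x ∈ Ω
    · rw [indicator_of_mem h]
    · rw [indicator_of_notMem h, hf x h]

theorem lintegral_unifOn {Ω : Set Pl} (hΩ : MeasurableSet Ω)
    {f : Pl → ℝ≥0∞} (hf : ∀ x ∉ Ω, f x = 0) :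
    ∫⁻ x, f x ∂(unifOn Ω) = (volume Ω)⁻¹ * ∫⁻ x, f x := by
  rw [unifOn, lintegral_smul_measure, setLIntegral_eq_lintegral_of_forall_notMem hΩ hf,
    smul_eq_mul]

/-- **Planar flux identities.**  Let `Ω ⊂ ℝ²` be compact convex with nonempty
interior, `A = area Ω`, and let `w : ℝ² × ℝ² → [0,1]` be measurable, symmetric and
vanishing outside `Ω × Ω`.  Then
`Cr_Ω(w) = ∫_Ω ∫₀^{2π} ∫₀^{2π} g_Ω(x,θ) g_Ω(x,φ) |sin(θ−φ)| dθ dφ dx` and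
`e_Ω(w) = ∫_Ω ∫₀^{2π} a_Ω(x,θ) dθ dx`. -/
theorem planar_flux_identities
    (Ω : Set Pl) (hΩc : IsCompact Ω) (hΩconv : Convex ℝ Ω)
    (hΩint : (interior Ω).Nonempty)
    (w : Pl → Pl → ℝ) (hmeas : Measurable (Function.uncurry w))
    (hsymm : ∀ x y, w x y = w y x)
    (hrange : ∀ x y, w x y ∈ Set.Icc (0:ℝ) 1)
    (hvanish : ∀ x y, ¬ (x ∈ Ω ∧ y ∈ Ω) → w x y = 0) :
    crPl Ω w =
      ∫⁻ x in Ω, (∫⁻ θ in Set.Ico 0 (2 * π), ∫⁻ φ in Set.Ico 0 (2 * π),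
        gPl (volume Ω).toReal w x θ * gPl (volume Ω).toReal w x φ *
          ENNReal.ofReal |Real.sin (θ - φ)|) ∧
    ePl Ω w =
      ∫⁻ x in Ω, (∫⁻ θ in Set.Ico 0 (2 * π), aPl (volume Ω).toReal w x θ) := by
  have hΩm : MeasurableSet Ω := hΩc.isClosed.measurableSet
  have hc : (volume Ω)⁻¹ ≠ ∞ :=
    ENNReal.inv_ne_top.2 (Measure.measure_pos_of_nonempty_interior _ hΩint).ne'
  have hA : (ENNReal.ofReal ((volume Ω).toReal ^ 2))⁻¹ = (volume Ω)⁻¹ * (volume Ω)⁻¹ := by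
    rw [ENNReal.ofReal_pow ENNReal.toReal_nonneg, ENNReal.ofReal_toReal hΩc.measure_lt_top.ne,
      ENNReal.inv_pow, sq]
  generalize hcV : (volume Ω)⁻¹ = c at hc hA
  set W : Pl → Pl → ℝ≥0∞ := fun x y => ENNReal.ofReal (w x y) with hWdef
  have hW : Measurable fun p : Pl × Pl => W p.1 p.2 := hmeas.ennreal_ofReal
  have hW0 : ∀ x y, ¬ (x ∈ Ω ∧ y ∈ Ω) → W x y = 0 := fun x y h => by
    simp [W, hvanish x y h]
  have hW1 : ∀ x y, x ∉ Ω → W x y = 0 := fun x y h => hW0 x y fun h' => h h'.1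
  have hW2 : ∀ x y, y ∉ Ω → W x y = 0 := fun x y h => hW0 x y fun h' => h h'.2
  have hL := measurable_chordMass hW
  have hLx : ∀ x, Measurable (chordMass W x) := fun x => hL.comp measurable_prodMk_left
  have hg : ∀ x θ, gPl (volume Ω).toReal w x θ = c * c *
      ∫⁻ t in Ioi (0 : ℝ), ENNReal.ofReal t * (ENNReal.ofReal t * chordMass W x (t • vθ θ)) := by
    intro x θ
    rw [gPl, hA, ← lintegral_quadrant_mul_eq_chordMass hW]
    congr 1
    refine setLIntegral_congr_fun (measurableSet_Ioi.prod measurableSet_Ioi) fun p hp => ?_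
    exact ENNReal.ofReal_mul (add_pos hp.1 hp.2).le
  have ha : ∀ x θ, aPl (volume Ω).toReal w x θ = c * c *
      ∫⁻ t in Ioi (0 : ℝ), ENNReal.ofReal t * chordMass W x (t • vθ θ) := by
    intro x θ
    rw [aPl, hA, ← lintegral_quadrant_eq_chordMass hW]
  have hcc : c * c ≠ ∞ := ENNReal.mul_ne_top hc hc
  have hcccc : c * c * (c * c) ≠ ∞ := ENNReal.mul_ne_top hcc hcc
  constructor
  · have hcr : crPl Ω w = c * c * (c * c) *
        ∫⁻ x₁, ∫⁻ x₂, ∫⁻ x₃, ∫⁻ x₄, W x₁ x₂ * W x₃ x₄ * pCrossInd x₁ x₂ x₃ x₄ := by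
      have h4 : ∀ x₁ x₂ x₃, ∫⁻ x₄, W x₁ x₂ * W x₃ x₄ * pCrossInd x₁ x₂ x₃ x₄ ∂(unifOn Ω) =
          c * ∫⁻ x₄, W x₁ x₂ * W x₃ x₄ * pCrossInd x₁ x₂ x₃ x₄ := fun x₁ x₂ x₃ => by
        rw [lintegral_unifOn hΩm, hcV]
        intro x hx; simp [hW2 _ _ hx]
      have h3 : ∀ x₁ x₂, ∫⁻ x₃, ∫⁻ x₄, W x₁ x₂ * W x₃ x₄ * pCrossInd x₁ x₂ x₃ x₄
          ∂(unifOn Ω) ∂(unifOn Ω) =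
          c * (c * ∫⁻ x₃, ∫⁻ x₄, W x₁ x₂ * W x₃ x₄ * pCrossInd x₁ x₂ x₃ x₄) := fun x₁ x₂ => by
        simp_rw [h4]
        rw [lintegral_unifOn hΩm, hcV, lintegral_const_mul' _ _ hc]
        intro x hx; simp [hW1 _ _ hx]
      have h2 : ∀ x₁, ∫⁻ x₂, ∫⁻ x₃, ∫⁻ x₄, W x₁ x₂ * W x₃ x₄ * pCrossInd x₁ x₂ x₃ x₄
          ∂(unifOn Ω) ∂(unifOn Ω) ∂(unifOn Ω) =
          c * (c * (c * ∫⁻ x₂, ∫⁻ x₃, ∫⁻ x₄,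
            W x₁ x₂ * W x₃ x₄ * pCrossInd x₁ x₂ x₃ x₄)) := fun x₁ => by
        simp_rw [h3]
        rw [lintegral_unifOn hΩm, hcV, lintegral_const_mul' _ _ hc, lintegral_const_mul' _ _ hc]
        intro x hx; simp [hW2 _ _ hx]
      change ∫⁻ x₁, ∫⁻ x₂, ∫⁻ x₃, ∫⁻ x₄, W x₁ x₂ * W x₃ x₄ * pCrossInd x₁ x₂ x₃ x₄
          ∂(unifOn Ω) ∂(unifOn Ω) ∂(unifOn Ω) ∂(unifOn Ω) = _
      simp_rw [h2]
      rw [lintegral_unifOn hΩm, hcV, lintegral_const_mul' _ _ hc, lintegral_const_mul' _ _ hc,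
        lintegral_const_mul' _ _ hc]
      · ring
      · intro x hx; simp [hW1 _ _ hx]
    rw [setLIntegral_eq_lintegral_of_forall_notMem hΩm, hcr, lintegral_pCrossInd hW,
      ← lintegral_const_mul' _ _ hcccc]
    · refine lintegral_congr fun x => ?_
      rw [lintegral_det2_mul_eq_polar (hLx x), ← lintegral_const_mul' _ _ hcccc]
      refine lintegral_congr fun θ => ?_
      rw [← lintegral_const_mul' _ _ hcccc]
      refine lintegral_congr fun φ => ?_
      rw [hg, hg]
      ring
    · intro x hx
      simp [hg, chordMass_eq_zero hΩconv hW0 hx]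
  · have he : ePl Ω w = c * c * ∫⁻ y, ∫⁻ z, W y z := by
      have h2 : ∀ y, ∫⁻ z, W y z ∂(unifOn Ω) = c * ∫⁻ z, W y z := fun y => by
        rw [lintegral_unifOn hΩm (hW2 y), hcV]
      change ∫⁻ y, ∫⁻ z, W y z ∂(unifOn Ω) ∂(unifOn Ω) = _
      simp_rw [h2]
      rw [lintegral_unifOn hΩm, hcV, lintegral_const_mul' _ _ hc, mul_assoc]
      intro x hx; simp [hW1 _ _ hx]
    rw [setLIntegral_eq_lintegral_of_forall_notMem hΩm, he, ← lintegral_chordMass hW,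
      ← lintegral_const_mul' _ _ hcc]
    · refine lintegral_congr fun x => ?_
      rw [lintegral_eq_polar (hLx x), ← lintegral_const_mul' _ _ hcc]
      exact lintegral_congr fun θ => (ha x θ).symm
    · intro x hx
      simp [ha, chordMass_eq_zero hΩconv hW0 hx]
end
end

section
/- Let τ ∈ [0,π] and let b : [0,π] → [0,∞) be a measurable function with b(u) ≤ sin u for all u ∈ [0,π] and ∫₀^π b(u) du = 1 − cos τ. Then ∫₀^π u·b(u) du ≥ sin τ − τ·cos τ. -/
open MeasureTheory Real Set

/-- **Bathtub principle.**  Let `τ ∈ [0,π]` and let `b : [0,π] → [0,∞)` be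
measurable with `b(u) ≤ sin u` on `[0,π]` and `∫₀^π b(u) du = 1 − cos τ`.
Then `∫₀^π u b(u) du ≥ sin τ − τ cos τ`. -/
theorem bathtub_principle
    (τ : ℝ) (hτ : τ ∈ Set.Icc 0 π)
    (b : ℝ → ℝ) (hb : Measurable b)
    (hb0 : ∀ u ∈ Set.Icc (0:ℝ) π, 0 ≤ b u)
    (hble : ∀ u ∈ Set.Icc (0:ℝ) π, b u ≤ Real.sin u)
    (hmass : ∫ u in Set.Icc (0:ℝ) π, b u = 1 - Real.cos τ) :
    Real.sin τ - τ * Real.cos τ ≤ ∫ u in Set.Icc (0:ℝ) π, u * b u := by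
  have hbi : IntegrableOn b (Icc 0 π) := by
    refine Integrable.mono' (continuous_sin.integrableOn_Icc) hb.aestronglyMeasurable ?_
    filter_upwards [ae_restrict_mem measurableSet_Icc] with u hu
    rw [Real.norm_eq_abs, abs_of_nonneg (hb0 u hu)]
    exact hble u hu
  have hubi : IntegrableOn (fun u => u * b u) (Icc 0 π) :=
    hbi.continuousOn_mul continuousOn_id isCompact_Icc
  have hdi : IntegrableOn (fun u => (u - τ) * b u) (Icc 0 π) :=
    hbi.continuousOn_mul (by fun_prop) isCompact_Icc
  have hd : ∫ u in Icc (0:ℝ) π, (u - τ) * b u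
      = (∫ u in Icc (0:ℝ) π, u * b u) - τ * (1 - Real.cos τ) := by
    simp_rw [sub_mul]
    rw [integral_sub hubi (hbi.const_mul τ), integral_const_mul, hmass]
  have hsub : Icc 0 τ ⊆ Icc 0 π := Icc_subset_Icc_right hτ.2
  -- Above `τ` the weight `u - τ` is nonnegative, so that part of the mass can be dropped.
  have hdrop : ∫ u in Icc (0:ℝ) τ, (u - τ) * b u ≤ ∫ u in Icc (0:ℝ) π, (u - τ) * b u := by
    rw [← integral_indicator measurableSet_Icc, ← integral_indicator measurableSet_Icc]
    refine integral_mono ((hdi.mono_set hsub).integrable_indicator measurableSet_Icc)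
      (hdi.integrable_indicator measurableSet_Icc) fun u => ?_
    by_cases h : u ∈ Icc 0 τ
    · simp only [indicator_of_mem h, indicator_of_mem (hsub h), le_refl]
    · rw [indicator_of_notMem h]
      refine indicator_apply_nonneg fun hu => mul_nonneg ?_ (hb0 u hu)
      exact sub_nonneg.2 (not_le.1 fun hle => h ⟨hu.1, hle⟩).le
  -- Below `τ` the weight is nonpositive, so filling `b` up to `sin` decreases the integral.
  have hfill : ∫ u in Icc (0:ℝ) τ, (u - τ) * Real.sin u ≤ ∫ u in Icc (0:ℝ) τ, (u - τ) * b u := by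
    refine setIntegral_mono_on (Continuous.integrableOn_Icc (by fun_prop)) (hdi.mono_set hsub)
      measurableSet_Icc fun u hu => ?_
    exact mul_le_mul_of_nonpos_left (hble u (hsub hu)) (sub_nonpos.2 hu.2)
  have hsin : ∫ u in Icc (0:ℝ) τ, (u - τ) * Real.sin u = Real.sin τ - τ := by
    rw [integral_Icc_eq_integral_Ioc, ← intervalIntegral.integral_of_le hτ.1,
      intervalIntegral.integral_eq_sub_of_hasDerivAt
        (f := fun u => Real.sin u - (u - τ) * Real.cos u) (fun u _ => ?_)
        (Continuous.intervalIntegrable (by fun_prop) _ _)]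
    · simp
    · refine ((Real.hasDerivAt_sin u).sub
        (((hasDerivAt_id u).sub_const τ).mul (Real.hasDerivAt_cos u))).congr_deriv ?_
      simp only [id]
      ring
  linarith
end
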